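/- Let Σ be a topologically transitive countable Markov shift and let φ : Σ → ℝ be a summable Markov potential with Var_1(φ) < ∞ and P_G(φ) < ∞, and for each t ≥ 1 let μ_t be a Gurevich–Markov measure for the potential tφ. If t_k → ∞ and the measures μ_{t_k} converge in the weak* topology to a Borel probability measure μ_∞ on Σ, then μ_∞ is σ-invariant and φ-maximizing, i.e. ∫φ dμ_∞ = α(φ). -/

import Mathlib

open MeasureTheory Filter Topology BoundedContinuousFunction
open scoped ENNReal NNReal

noncomputable section

/-! ## Countable Markov shifts (one-sided) -/

/-- The one-sided countable Markov shift over the alphabet `ℕ` determined by the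
transition matrix (relation) `A`. -/
structure MShift (A : ℕ → ℕ → Prop) : Type where
  seq : ℕ → ℕ
  adm : ∀ i : ℕ, A (seq i) (seq (i + 1))

/-- The topology generated by the cylinders: the topology induced from the product
topology on `ℕ → ℕ` (with `ℕ` discrete). -/
instance (A : ℕ → ℕ → Prop) : TopologicalSpace (MShift A) :=
  TopologicalSpace.induced MShift.seq inferInstance

/-- The Borel σ-algebra on the shift space. -/
instance (A : ℕ → ℕ → Prop) : MeasurableSpace (MShift A) := borel (MShift A)

instance (A : ℕ → ℕ → Prop) : BorelSpace (MShift A) := ⟨rfl⟩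

/-- The shift map `σ`. -/
def shiftMap (A : ℕ → ℕ → Prop) (x : MShift A) : MShift A :=
  ⟨fun i => x.seq (i + 1), fun i => x.adm (i + 1)⟩

/-- No row and no column of the transition matrix is identically zero. -/
def NoZeroRC (A : ℕ → ℕ → Prop) : Prop :=
  ∀ i : ℕ, (∃ j, A i j) ∧ (∃ j, A j i)

/-- The cylinder `[x₀ … x_{n-1}]` determined by a finite word `w`. -/
def cylSet (A : ℕ → ℕ → Prop) (w : List ℕ) : Set (MShift A) :=
  {x | ∀ i < w.length, x.seq i = w.getD i 0}

/-- A path: an admissible word `x₀ … xₙ` with `n ≥ 1` and nonempty cylinder. -/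
def IsPath (A : ℕ → ℕ → Prop) (w : List ℕ) : Prop :=
  2 ≤ w.length ∧ w.Chain' A ∧ (cylSet A w).Nonempty

/-- The length `l(γ) = n` of a path `γ = x₀ … xₙ` (represented as a list of `n+1` symbols). -/
def pathLen (w : List ℕ) : ℕ := w.length - 1

/-- The weight `φ(γ) = Σ_{k=0}^{n-1} ψ(x_k x_{k+1})` of a word under a Markov
potential determined by `ψ : ℕ → ℕ → ℝ`. -/
def pathWt (ψ : ℕ → ℕ → ℝ) : List ℕ → ℝ
  | [] => 0
  | [_] => 0
  | a :: b :: l => ψ a b + pathWt ψ (b :: l)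

/-- Topological transitivity: any two symbols are connected by a path. -/
def TopTrans (A : ℕ → ℕ → Prop) : Prop :=
  ∀ a b : ℕ, ∃ w : List ℕ, IsPath A w ∧ w.headI = a ∧ w.getLastD 0 = b

/-- The Birkhoff sum `Sₙφ`. -/
def birkhoff (A : ℕ → ℕ → Prop) (φ : MShift A → ℝ) (n : ℕ) (x : MShift A) : ℝ :=
  ∑ i ∈ Finset.range n, φ ((shiftMap A)^[i] x)

/-- The Gurevich partition function `Zₙ(φ, a)`. -/
def Zpart (A : ℕ → ℕ → Prop) (φ : MShift A → ℝ) (n : ℕ) (a : ℕ) : ℝ≥0∞ :=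
  ∑' x : {x : MShift A // (shiftMap A)^[n] x = x ∧ x.seq 0 = a},
    ENNReal.ofReal (Real.exp (birkhoff A φ n x.1))

/-- `Zₙ*(φ, a)`: the partition function restricted to first returns to `a`. -/
def ZpartStar (A : ℕ → ℕ → Prop) (φ : MShift A → ℝ) (n : ℕ) (a : ℕ) : ℝ≥0∞ :=
  ∑' x : {x : MShift A // (shiftMap A)^[n] x = x ∧ x.seq 0 = a ∧
      ∀ k, 0 < k → k < n → x.seq k ≠ a},
    ENNReal.ofReal (Real.exp (birkhoff A φ n x.1))

/-- The Gurevich pressure `P_G(φ) = limsup (1/n) log Zₙ(φ, a)` (at the symbol `a`),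
as an extended real number. -/
def PGur (A : ℕ → ℕ → Prop) (φ : MShift A → ℝ) (a : ℕ) : EReal :=
  Filter.atTop.limsup fun n : ℕ => (((n : ℝ)⁻¹ : ℝ) : EReal) * ENNReal.log (Zpart A φ n a)

/-- `p` is the (common, symbol-independent) value of the Gurevich pressure of `φ`. -/
def IsPG (A : ℕ → ℕ → Prop) (φ : MShift A → ℝ) (p : EReal) : Prop :=
  ∀ a : ℕ, (∃ x : MShift A, x.seq 0 = a) → PGur A φ a = p

/-- `φ` is a summable potential: `Σᵢ exp (sup φ|_[i]) < ∞`. -/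
def SummablePot (A : ℕ → ℕ → Prop) (φ : MShift A → ℝ) : Prop :=
  ∃ s : ℕ → ℝ, Summable (fun i => Real.exp (s i)) ∧
    ∀ (i : ℕ) (x : MShift A), x.seq 0 = i → φ x ≤ s i

/-- `V` is a bound for the `n`-th variation `Varₙ(φ)`. -/
def VarBdd (A : ℕ → ℕ → Prop) (φ : MShift A → ℝ) (n : ℕ) (V : ℝ) : Prop :=
  ∀ x y : MShift A, (∀ i < n, x.seq i = y.seq i) → |φ x - φ y| ≤ V

/-- σ-invariance of a Borel measure on the shift space. -/
def ShiftInv (A : ℕ → ℕ → Prop) (μ : Measure (MShift A)) : Prop :=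
  ∀ s : Set (MShift A), MeasurableSet s → μ (shiftMap A ⁻¹' s) = μ s

/-- The maximal ergodic average `α(φ)`. -/
def alphaSup (A : ℕ → ℕ → Prop) (φ : MShift A → ℝ) : ℝ :=
  sSup {r : ℝ | ∃ μ : Measure (MShift A), IsProbabilityMeasure μ ∧ ShiftInv A μ ∧
    Integrable φ μ ∧ r = ∫ x, φ x ∂μ}

/-- `μ` is the Gurevich–Markov (stationary Markov equilibrium) measure associated to the
Markov potential `ψ` with pressure `p`. -/
structure IsGM (A : ℕ → ℕ → Prop) (ψ : ℕ → ℕ → ℝ) (p : ℝ) (μ : Measure (MShift A)) : Prop where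
  prob : IsProbabilityMeasure μ
  inv : ShiftInv A μ
  eigen : ∃ h hT : ℕ → ℝ, (∀ a, 0 < h a) ∧ (∀ a, 0 < hT a) ∧
    (∀ j : ℕ, (∑' a : {a : ℕ // A a j}, ENNReal.ofReal (Real.exp (ψ a.1 j) * h a.1))
        = ENNReal.ofReal (Real.exp p * h j)) ∧
    (∀ j : ℕ, (∑' b : {b : ℕ // A j b}, ENNReal.ofReal (Real.exp (ψ j b.1) * hT b.1))
        = ENNReal.ofReal (Real.exp p * hT j)) ∧
    (∑' a : ℕ, ENNReal.ofReal (h a * hT a)) = 1 ∧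
    (∀ w : List ℕ, w ≠ [] → w.Chain' A → (cylSet A w).Nonempty →
      μ (cylSet A w) = ENNReal.ofReal
        (h w.headI * hT (w.getLastD 0) * Real.exp (pathWt ψ w - (pathLen w : ℝ) * p)))

/-! ## Loops and main paths (one-sided) -/

/-- A loop at `a`. -/
def IsLoopAt (A : ℕ → ℕ → Prop) (a : ℕ) (w : List ℕ) : Prop :=
  IsPath A w ∧ w.headI = a ∧ w.getLastD 0 = a

/-- The word `w` passes through `b`, i.e. some intermediate symbol of `w` equals `b`. -/
def PassesThrough (w : List ℕ) (b : ℕ) : Prop :=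
  ∃ m, 0 < m ∧ m < w.length - 1 ∧ w.getD m 0 = b

/-- No intermediate symbol of `w` lies in `J`. -/
def AvoidsIn (w : List ℕ) (J : Finset ℕ) : Prop :=
  ∀ m, 0 < m → m < w.length - 1 → w.getD m 0 ∉ J

/-- A first-return loop at `c`: a loop at `c` with no intermediate occurrence of `c`. -/
def FirstRetLoop (A : ℕ → ℕ → Prop) (c : ℕ) (w : List ℕ) : Prop :=
  IsPath A w ∧ w.headI = c ∧ w.getLastD 0 = c ∧
    ∀ m, 0 < m → m < w.length - 1 → w.getD m 0 ≠ c

/-- A main path from `i` to `j` (relative to the pair of symbols `{a, b}`): a path from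
`i` to `j` with no intermediate occurrence of `a` nor of `b`. -/
def MainPath (A : ℕ → ℕ → Prop) (a b i j : ℕ) (w : List ℕ) : Prop :=
  IsPath A w ∧ w.headI = i ∧ w.getLastD 0 = j ∧
    ∀ m, 0 < m → m < w.length - 1 → w.getD m 0 ≠ a ∧ w.getD m 0 ≠ b

/-- `p_{ij}^t`: the sum of `exp(ψ(γ) − l(γ)·p)` over all main paths from `i` to `j`. -/
def pSum (A : ℕ → ℕ → Prop) (ψ : ℕ → ℕ → ℝ) (p : ℝ) (a b i j : ℕ) : ℝ≥0∞ :=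
  ∑' w : {w : List ℕ // MainPath A a b i j w},
    ENNReal.ofReal (Real.exp (pathWt ψ w.1 - (pathLen w.1 : ℝ) * p))

/-- `r_{ij}^t`: as `pSum`, restricted to main paths all of whose symbols lie in `S'`. -/
def rSum (A : ℕ → ℕ → Prop) (ψ : ℕ → ℕ → ℝ) (p : ℝ) (a b i j : ℕ) (S' : Finset ℕ) : ℝ≥0∞ :=
  ∑' w : {w : List ℕ // MainPath A a b i j w ∧ ∀ m < w.length, w.getD m 0 ∈ S'},
    ENNReal.ofReal (Real.exp (pathWt ψ w.1 - (pathLen w.1 : ℝ) * p))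

/-- Number of intermediate occurrences of symbols of `I` in the word `w`. -/
def interCount (I : Finset ℕ) (w : List ℕ) : ℕ :=
  ((w.drop 1).take (w.length - 2)).countP (fun s => decide (s ∈ I))

/-- `p_{ij}^t(n)`: as `pSum`, restricted to main paths with exactly `n` intermediate
occurrences of symbols of `I`. -/
def pSumN (A : ℕ → ℕ → Prop) (ψ : ℕ → ℕ → ℝ) (p : ℝ) (a b i j : ℕ)
    (I : Finset ℕ) (n : ℕ) : ℝ≥0∞ :=
  ∑' w : {w : List ℕ // MainPath A a b i j w ∧ interCount I w = n},
    ENNReal.ofReal (Real.exp (pathWt ψ w.1 - (pathLen w.1 : ℝ) * p))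

/-- An `I`-free path from `i` to `j`: a path from `i` to `j` with no intermediate
symbol in `I`. -/
def IFree (A : ℕ → ℕ → Prop) (I : Finset ℕ) (i j : ℕ) (w : List ℕ) : Prop :=
  IsPath A w ∧ w.headI = i ∧ w.getLastD 0 = j ∧
    ∀ m, 0 < m → m < w.length - 1 → w.getD m 0 ∉ I

/-! ## Two-sided countable Markov shifts -/

/-- The two-sided countable Markov shift determined by `A`. -/
structure MShift2 (A : ℕ → ℕ → Prop) : Type where
  seq : ℤ → ℕ
  adm : ∀ i : ℤ, A (seq i) (seq (i + 1))

instance (A : ℕ → ℕ → Prop) : TopologicalSpace (MShift2 A) :=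
  TopologicalSpace.induced MShift2.seq inferInstance

instance (A : ℕ → ℕ → Prop) : MeasurableSpace (MShift2 A) := borel (MShift2 A)

instance (A : ℕ → ℕ → Prop) : BorelSpace (MShift2 A) := ⟨rfl⟩

/-- The (invertible) shift map on the two-sided shift. -/
def shiftMap2 (A : ℕ → ℕ → Prop) (x : MShift2 A) : MShift2 A :=
  ⟨fun i => x.seq (i + 1), fun i => x.adm (i + 1)⟩

/-- Cylinder based at coordinate 0 in the two-sided shift. -/
def cylSet2 (A : ℕ → ℕ → Prop) (w : List ℕ) : Set (MShift2 A) :=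
  {x | ∀ i < w.length, x.seq (i : ℤ) = w.getD i 0}

/-- A path in the two-sided shift: an admissible word `x₀ … xₙ`, `n ≥ 1`. -/
def IsPath2 (A : ℕ → ℕ → Prop) (w : List ℕ) : Prop :=
  2 ≤ w.length ∧ w.Chain' A

/-- σ-invariance of a Borel measure on the two-sided shift. -/
def ShiftInv2 (A : ℕ → ℕ → Prop) (μ : Measure (MShift2 A)) : Prop :=
  ∀ s : Set (MShift2 A), MeasurableSet s → μ (shiftMap2 A ⁻¹' s) = μ s

/-- Main path from `i` to `j` relative to `{a, b}` in the two-sided shift. -/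
def MainPath2 (A : ℕ → ℕ → Prop) (a b i j : ℕ) (w : List ℕ) : Prop :=
  IsPath2 A w ∧ w.headI = i ∧ w.getLastD 0 = j ∧
    ∀ m, 0 < m → m < w.length - 1 → w.getD m 0 ≠ a ∧ w.getD m 0 ≠ b

/-- `p_{ij}`: the sum of `exp(ψ(γ) − l(γ)·P)` over all main paths from `i` to `j`
in the two-sided shift. -/
def pSum2 (A : ℕ → ℕ → Prop) (ψ : ℕ → ℕ → ℝ) (P : ℝ) (a b i j : ℕ) : ℝ≥0∞ :=
  ∑' w : {w : List ℕ // MainPath2 A a b i j w},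
    ENNReal.ofReal (Real.exp (pathWt ψ w.1 - (pathLen w.1 : ℝ) * P))

/-! ## The Ruelle operator and the renewal shift -/

/-- The Ruelle (transfer) operator acting on nonnegative measurable functions. -/
def ruelleOp (A : ℕ → ℕ → Prop) (ψ : MShift A → ℝ) (f : MShift A → ℝ≥0∞)
    (x : MShift A) : ℝ≥0∞ :=
  ∑' y : {y : MShift A // shiftMap A y = x}, ENNReal.ofReal (Real.exp (ψ y.1)) * f y.1

/-- The transition matrix of the renewal shift: `A(1,1) = A(1,i) = A(i, i-1) = 1` for
every `i > 1`, all other entries `0` (alphabet `{1, 2, …}`). -/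
def renewalA : ℕ → ℕ → Prop := fun i j => (i = 1 ∧ 1 ≤ j) ∨ (2 ≤ i ∧ j = i - 1)

/-- The potential `φ(x) = -x₀` on the renewal shift. -/
def phiRen : MShift renewalA → ℝ := fun x => -(x.seq 0 : ℝ)

/-- The potential `φ(x) = x₀ - x₁` on the renewal shift. -/
def phiRen2 : MShift renewalA → ℝ := fun x => (x.seq 0 : ℝ) - (x.seq 1 : ℝ)

/-- The fixed point `1̄ = (1,1,1,…)` of the renewal shift. -/
def onebar : MShift renewalA := ⟨fun _ => 1, fun _ => Or.inl ⟨rfl, le_refl 1⟩⟩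

end

section MarkovShift

variable {A : ℕ → ℕ → Prop}

theorem MShift.continuous_seq (i : ℕ) : Continuous fun x : MShift A => x.seq i :=
  (continuous_apply i).comp continuous_induced_dom

theorem continuous_shiftMap : Continuous (shiftMap A) :=
  continuous_induced_rng.2 (continuous_pi fun i => MShift.continuous_seq (i + 1))

instance : TopologicalSpace.PseudoMetrizableSpace (MShift A) :=
  (Topology.IsInducing.mk rfl : Topology.IsInducing (MShift.seq (A := A))).pseudoMetrizableSpace

theorem shiftMap_iterate_seq (n : ℕ) (x : MShift A) (i : ℕ) :
    ((shiftMap A)^[n] x).seq i = x.seq (n + i) := by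
  induction n generalizing x with
  | zero => simp
  | succ n ih => rw [Function.iterate_succ_apply, ih]; simp only [shiftMap]; congr 1; omega

theorem ShiftInv.measurePreserving {μ : Measure (MShift A)} (h : ShiftInv A μ) :
    MeasurePreserving (shiftMap A) μ μ :=
  ⟨continuous_shiftMap.measurable, Measure.ext fun s hs => by
    rw [Measure.map_apply continuous_shiftMap.measurable hs, h s hs]⟩

theorem measurable_birkhoff {f : MShift A → ℝ} (hf : Measurable f) (n : ℕ) :
    Measurable (birkhoff A f n) :=
  Finset.measurable_fun_sum _ fun i _ => hf.comp (continuous_shiftMap.measurable.iterate i)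

theorem ShiftInv.integrable_iterate {μ : Measure (MShift A)} (hμ : ShiftInv A μ)
    {f : MShift A → ℝ} (hf : Integrable f μ) (i : ℕ) :
    Integrable (fun x => f ((shiftMap A)^[i] x)) μ :=
  ((hμ.measurePreserving.iterate i).integrable_comp hf.aestronglyMeasurable).2 hf

theorem ShiftInv.integrable_birkhoff {μ : Measure (MShift A)} (hμ : ShiftInv A μ)
    {f : MShift A → ℝ} (hf : Integrable f μ) (n : ℕ) : Integrable (birkhoff A f n) μ :=
  integrable_finsetSum _ fun i _ => hμ.integrable_iterate hf i

theorem ShiftInv.integral_birkhoff {μ : Measure (MShift A)} (hμ : ShiftInv A μ)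
    {f : MShift A → ℝ} (hf : Integrable f μ) (n : ℕ) :
    ∫ x, birkhoff A f n x ∂μ = n * ∫ x, f x ∂μ := by
  have key (i : ℕ) : ∫ x, f ((shiftMap A)^[i] x) ∂μ = ∫ x, f x ∂μ := by
    have hmp := hμ.measurePreserving.iterate i
    have h := integral_map hmp.measurable.aemeasurable
      (f := f) (by rw [hmp.map_eq]; exact hf.aestronglyMeasurable)
    rw [← h, hmp.map_eq]
  unfold birkhoff
  rw [integral_finsetSum _ fun i _ => hμ.integrable_iterate hf i]
  simp [key]

/-- If the Birkhoff averages of a function bounded above are asymptotically at most `p` outside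
sets of arbitrarily small measure, then its integral is at most `p`. -/
theorem ShiftInv.integral_le_of_birkhoff_le {μ : Measure (MShift A)} [IsProbabilityMeasure μ]
    (hμ : ShiftInv A μ) {f : MShift A → ℝ} (hf : Integrable f μ) {K p : ℝ}
    (hK : ∀ x, f x ≤ K)
    (h : ∀ δ > 0, ∃ C : ℝ, ∀ᶠ n : ℕ in atTop, ∃ E : Set (MShift A), MeasurableSet E ∧
      μ.real E ≤ δ ∧ ∀ x ∉ E, birkhoff A f n x ≤ n * p + C) :
    ∫ x, f x ∂μ ≤ p := by
  set B : ℝ := |K| + |p| with hB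
  have hB0 : 0 ≤ B := by positivity
  have step : ∀ δ > 0, ∫ x, f x ∂μ ≤ p + δ * B := by
    intro δ hδ
    obtain ⟨C, hC⟩ := h δ hδ
    have hev : ∀ᶠ n : ℕ in atTop, ∫ x, f x ∂μ ≤ p + |C| / n + δ * B := by
      filter_upwards [hC, eventually_gt_atTop 0] with n ⟨E, hE, hEδ, hEx⟩ hn
      have hn' : (0 : ℝ) < n := by exact_mod_cast hn
      have hpt (x : MShift A) :
          birkhoff A f n x ≤ (n * p + |C|) + E.indicator (fun _ => n * B) x := by
        by_cases hx : x ∈ E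
        · have h1 : birkhoff A f n x ≤ n * K := by
            unfold birkhoff
            calc _ ≤ ∑ i ∈ Finset.range n, K := Finset.sum_le_sum fun i _ => hK _
              _ = n * K := by simp
          have h2 : (n : ℝ) * K ≤ n * p + n * B := by
            rw [← mul_add]
            refine mul_le_mul_of_nonneg_left ?_ hn'.le
            linarith [le_abs_self K, neg_abs_le p]
          simp only [Set.indicator_of_mem hx]
          linarith [abs_nonneg C]
        · simp only [Set.indicator_of_notMem hx]
          linarith [hEx x hx, le_abs_self C]
      have hint : Integrable (fun x => (n * p + |C|) + E.indicator (fun _ => (n : ℝ) * B) x) μ :=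
        (integrable_const _).add ((integrable_const _).indicator hE)
      have := integral_mono (hμ.integrable_birkhoff hf n) hint hpt
      rw [hμ.integral_birkhoff hf, integral_add (integrable_const _)
        ((integrable_const _).indicator hE), integral_indicator_const _ hE] at this
      simp only [integral_const, probReal_univ, smul_eq_mul, one_mul] at this
      have h3 : μ.real E * (n * B) ≤ δ * (n * B) := by gcongr
      have h4 : (n : ℝ) * ∫ x, f x ∂μ ≤ n * (p + |C| / n + δ * B) := by
        have : (n : ℝ) * (|C| / n) = |C| := by field_simp
        nlinarith
      exact le_of_mul_le_mul_left h4 hn'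
    have hlim : Tendsto (fun n : ℕ => p + |C| / n + δ * B) atTop (𝓝 (p + 0 + δ * B)) :=
      (tendsto_const_nhds.add (tendsto_const_div_atTop_nhds_zero_nat _)).add tendsto_const_nhds
    simpa using ge_of_tendsto hlim hev
  refine le_of_forall_pos_le_add fun ε hε => ?_
  refine (step (ε / (B + 1)) (by positivity)).trans ?_
  have : ε / (B + 1) * B ≤ ε := by
    rw [div_mul_eq_mul_div, div_le_iff₀ (by positivity)]; nlinarith
  linarith

theorem measurableSet_le_seq (n N : ℕ) : MeasurableSet {x : MShift A | N ≤ x.seq n} :=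
  (MShift.continuous_seq n).measurable measurableSet_Ici

theorem exists_measure_le_seq_le (μ : Measure (MShift A)) [IsProbabilityMeasure μ]
    {δ : ℝ} (hδ : 0 < δ) : ∃ N : ℕ, μ.real {x | N ≤ x.seq 0} ≤ δ := by
  have h := tendsto_measure_iInter_atTop (μ := μ) (s := fun N : ℕ => {x : MShift A | N ≤ x.seq 0})
    (fun N => (measurableSet_le_seq 0 N).nullMeasurableSet)
    (fun a b hab x hx => le_trans hab hx) ⟨0, measure_ne_top _ _⟩
  have he : ⋂ N : ℕ, {x : MShift A | N ≤ x.seq 0} = ∅ := by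
    ext x
    simp only [Set.mem_iInter, Set.mem_ofPred_eq, Set.mem_empty_iff_false, iff_false, not_forall]
    exact ⟨x.seq 0 + 1, by omega⟩
  rw [he, measure_empty] at h
  obtain ⟨N, hN⟩ := (h.eventually_le_const (ENNReal.ofReal_pos.2 hδ)).exists
  exact ⟨N, ENNReal.toReal_le_of_le_ofReal hδ.le hN⟩

/-- Off a set of small measure, both the `0`-th and the `n`-th symbols lie in a fixed finite set. -/
theorem ShiftInv.exists_measure_endpoints_le {μ : Measure (MShift A)} [IsProbabilityMeasure μ]
    (hμ : ShiftInv A μ) {δ : ℝ} (hδ : 0 < δ) :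
    ∃ N : ℕ, ∀ n, μ.real ({x | N ≤ x.seq 0} ∪ {x | N ≤ x.seq n}) ≤ δ := by
  obtain ⟨N, hN⟩ := exists_measure_le_seq_le μ (half_pos hδ)
  refine ⟨N, fun n => (measureReal_union_le _ _).trans ?_⟩
  have h : μ.real {x | N ≤ x.seq n} = μ.real {x | N ≤ x.seq 0} := by
    have := (hμ.measurePreserving.iterate n).measure_preimage
      (measurableSet_le_seq 0 N).nullMeasurableSet
    simp only [Set.preimage_ofPred_eq, shiftMap_iterate_seq, add_zero] at this
    simp [measureReal_def, this]
  linarith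

/-- The word `f 0, …, f n`. -/
def initialWord : (ℕ → ℕ) → ℕ → List ℕ
  | f, 0 => [f 0]
  | f, n + 1 => f 0 :: initialWord (fun i => f (i + 1)) n

theorem initialWord_eq_cons (f : ℕ → ℕ) (n : ℕ) : ∃ l, initialWord f n = f 0 :: l := by
  cases n <;> exact ⟨_, rfl⟩

theorem length_initialWord (f : ℕ → ℕ) (n : ℕ) : (initialWord f n).length = n + 1 := by
  induction n generalizing f with
  | zero => rfl
  | succ n ih => simp [initialWord, ih]

theorem getLastD_initialWord (f : ℕ → ℕ) (n d : ℕ) : (initialWord f n).getLastD d = f n := by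
  induction n generalizing f d with
  | zero => rfl
  | succ n ih => rw [initialWord, List.getLastD_cons, ih]

theorem getD_initialWord (f : ℕ → ℕ) (n i : ℕ) (hi : i ≤ n) : (initialWord f n).getD i 0 = f i := by
  induction n generalizing f i with
  | zero => obtain rfl : i = 0 := by omega
            rfl
  | succ n ih =>
    cases i with
    | zero => rfl
    | succ i => rw [initialWord, List.getD_cons_succ, ih _ _ (by omega)]

theorem isChain_initialWord {f : ℕ → ℕ} (hf : ∀ i, A (f i) (f (i + 1))) (n : ℕ) :
    (initialWord f n).IsChain A := by
  induction n generalizing f with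
  | zero => exact List.isChain_singleton _
  | succ n ih =>
    obtain ⟨l, hl⟩ := initialWord_eq_cons (fun i => f (i + 1)) n
    have := ih (f := fun i => f (i + 1)) fun i => hf (i + 1)
    rw [initialWord, hl]
    rw [hl] at this
    exact List.isChain_cons_cons.2 ⟨hf 0, this⟩

theorem pathWt_initialWord (ψ : ℕ → ℕ → ℝ) (f : ℕ → ℕ) (n : ℕ) :
    pathWt ψ (initialWord f n) = ∑ i ∈ Finset.range n, ψ (f i) (f (i + 1)) := by
  induction n generalizing f with
  | zero => rfl
  | succ n ih =>
    obtain ⟨l, hl⟩ := initialWord_eq_cons (fun i => f (i + 1)) n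
    have := ih fun i => f (i + 1)
    rw [hl] at this
    rw [initialWord, hl, pathWt, this, Finset.sum_range_succ']
    simp [add_comm]

theorem mem_cylSet_initialWord {f : ℕ → ℕ} {n : ℕ} {x : MShift A} :
    x ∈ cylSet A (initialWord f n) ↔ ∀ i ≤ n, x.seq i = f i := by
  simp only [cylSet, Set.mem_ofPred_eq, length_initialWord, Nat.lt_succ_iff]
  exact forall₂_congr fun i hi => by rw [getD_initialWord f n i hi]

theorem pathWt_const_mul (t : ℝ) (ψ : ℕ → ℕ → ℝ) (w : List ℕ) :
    pathWt (fun u v => t * ψ u v) w = t * pathWt ψ w := by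
  induction w with
  | nil => simp [pathWt]
  | cons a l ih =>
    cases l with
    | nil => simp [pathWt]
    | cons b l => rw [pathWt, pathWt, ih, mul_add]

theorem birkhoff_eq_sum {ψ : ℕ → ℕ → ℝ} {φ : MShift A → ℝ}
    (hφ : ∀ x, φ x = ψ (x.seq 0) (x.seq 1)) (n : ℕ) (x : MShift A) :
    birkhoff A φ n x = ∑ i ∈ Finset.range n, ψ (x.seq i) (x.seq (i + 1)) := by
  simp [birkhoff, hφ, shiftMap_iterate_seq]

theorem tsum_prod_fin (g : ℕ → ℝ≥0∞) (n : ℕ) :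
    ∑' w : Fin n → ℕ, ∏ i, g (w i) = (∑' a, g a) ^ n := by
  induction n with
  | zero => simp
  | succ n ih =>
    rw [← (Fin.consEquiv fun _ => ℕ).tsum_eq, ENNReal.tsum_prod', pow_succ', ← ih,
      ← ENNReal.tsum_mul_right]
    refine tsum_congr fun a => ?_
    rw [← ENNReal.tsum_mul_left]
    refine tsum_congr fun w => ?_
    simp [Fin.consEquiv, Fin.prod_univ_succ]

/-- The measure of the cylinder of length `n + 1` around `x`, for the Gurevich–Markov measure of
`t φ`. -/
theorem IsGM.exists_measure_cylSet {ψ : ℕ → ℕ → ℝ} {φ : MShift A → ℝ}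
    (hφ : ∀ x, φ x = ψ (x.seq 0) (x.seq 1)) {t p : ℝ} {μ : Measure (MShift A)}
    (h : IsGM A (fun u v => t * ψ u v) p μ) :
    ∃ u v : ℕ → ℝ, (∀ a, 0 < u a) ∧ (∀ a, 0 < v a) ∧ ∀ (n : ℕ) (x : MShift A),
      μ (cylSet A (initialWord x.seq n)) = ENNReal.ofReal
        (u (x.seq 0) * v (x.seq n) * Real.exp (t * birkhoff A φ n x - n * p)) := by
  obtain ⟨u, v, hu, hv, -, -, -, hc⟩ := h.eigen
  refine ⟨u, v, hu, hv, fun n x => ?_⟩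
  obtain ⟨l, hl⟩ := initialWord_eq_cons x.seq n
  rw [hc _ (by simp [hl]) (isChain_initialWord x.adm n)
    ⟨x, mem_cylSet_initialWord.2 fun _ _ => rfl⟩, getLastD_initialWord, pathWt_const_mul,
    pathWt_initialWord, ← birkhoff_eq_sum hφ, pathLen, length_initialWord, hl]
  simp

theorem exists_forall_lt_le (g : ℕ → ℕ → ℝ) (N : ℕ) :
    ∃ C : ℝ, ∀ a < N, ∀ b < N, g a b ≤ C := by
  obtain ⟨C, hC⟩ := (Finset.range N ×ˢ Finset.range N).finite_toSet.image
    (fun q => g q.1 q.2) |>.bddAbove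
  exact ⟨C, fun a ha b hb => hC ⟨(a, b), by simp [ha, hb], rfl⟩⟩

/-- A potential with a Gurevich–Markov measure at `t` has all its invariant averages at most
`p / t`. -/
theorem IsGM.integral_le {ψ : ℕ → ℕ → ℝ} {φ : MShift A → ℝ}
    (hφ : ∀ x, φ x = ψ (x.seq 0) (x.seq 1)) {K : ℝ} (hK : ∀ x, φ x ≤ K) {t p : ℝ} (ht : 0 < t)
    {μ : Measure (MShift A)} (h : IsGM A (fun u v => t * ψ u v) p μ)
    {ν : Measure (MShift A)} [IsProbabilityMeasure ν] (hν : ShiftInv A ν)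
    (hint : Integrable φ ν) : ∫ x, φ x ∂ν ≤ p / t := by
  have := h.prob
  obtain ⟨u, v, hu, hv, hc⟩ := h.exists_measure_cylSet hφ
  refine hν.integral_le_of_birkhoff_le hint hK fun δ hδ => ?_
  obtain ⟨N, hN⟩ := hν.exists_measure_endpoints_le hδ
  obtain ⟨C, hC⟩ := exists_forall_lt_le (fun a b => -Real.log (u a * v b)) N
  refine ⟨C / t, .of_forall fun n => ⟨_, (measurableSet_le_seq 0 N).union
    (measurableSet_le_seq n N), hN n, fun x hx => ?_⟩⟩
  simp only [Set.mem_union, Set.mem_ofPred_eq, not_or, not_le] at hx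
  have h1 : μ (cylSet A (initialWord x.seq n)) ≤ 1 := prob_le_one
  rw [hc, ENNReal.ofReal_le_one] at h1
  have huv : 0 < u (x.seq 0) * v (x.seq n) := mul_pos (hu _) (hv _)
  have h2 := Real.log_le_log (by positivity) h1
  rw [Real.log_mul huv.ne' (Real.exp_ne_zero _), Real.log_exp, Real.log_one] at h2
  have h3 := hC _ hx.1 _ hx.2
  rw [show n * (p / t) + C / t = (n * p + C) / t by ring, le_div_iff₀ ht]
  linarith

/-- Large deviation bound: for a Gurevich–Markov measure of `t φ`, the points whose orbit has small
Birkhoff average and whose endpoints are in a fixed finite set have exponentially small measure. -/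
theorem IsGM.exists_measure_birkhoff_le {ψ : ℕ → ℕ → ℝ} {φ : MShift A → ℝ}
    (hφ : ∀ x, φ x = ψ (x.seq 0) (x.seq 1)) {s : ℕ → ℝ} (hs : Summable fun i => Real.exp (s i))
    (hφs : ∀ x, φ x ≤ s (x.seq 0)) {t p β : ℝ} (ht : 1 ≤ t)
    {μ : Measure (MShift A)} (h : IsGM A (fun u v => t * ψ u v) p μ) (N : ℕ) :
    ∃ C : ℝ, ∀ n : ℕ,
      μ.real {x | x.seq 0 < N ∧ x.seq n < N ∧ birkhoff A φ n x ≤ n * β} ≤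
        C * (Real.exp ((t - 1) * β - p) * ∑' i, Real.exp (s i)) ^ n := by
  obtain ⟨u, v, hu, hv, hc⟩ := h.exists_measure_cylSet hφ
  obtain ⟨C, hC⟩ := exists_forall_lt_le (fun a b => u a * v b * Real.exp (-s b)) N
  set Z := ∑' i, Real.exp (s i) with hZ
  have hZ0 : 0 ≤ Z := tsum_nonneg fun i => (Real.exp_pos _).le
  refine ⟨|C| * Z, fun n => ?_⟩
  set B := {x : MShift A | x.seq 0 < N ∧ x.seq n < N ∧ birkhoff A φ n x ≤ n * β} with hB
  refine ENNReal.toReal_le_of_le_ofReal (by positivity) ?_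
  have hcover : B ⊆ ⋃ w : Fin (n + 1) → ℕ, B ∩ {x | ∀ i : Fin (n + 1), x.seq i = w i} :=
    fun x hx => Set.mem_iUnion.2 ⟨fun i => x.seq i, hx, fun _ => rfl⟩
  have hcyl (w : Fin (n + 1) → ℕ) : μ (B ∩ {x | ∀ i : Fin (n + 1), x.seq i = w i}) ≤
      ENNReal.ofReal (|C| * Real.exp ((t - 1) * β - p) ^ n) *
        ∏ i, ENNReal.ofReal (Real.exp (s (w i))) := by
    rcases (B ∩ {x | ∀ i : Fin (n + 1), x.seq i = w i}).eq_empty_or_nonempty with he | ⟨x, hxB, hxw⟩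
    · simp [he]
    · have hsub : B ∩ {x | ∀ i : Fin (n + 1), x.seq i = w i} ⊆ cylSet A (initialWord x.seq n) :=
        fun y hy => mem_cylSet_initialWord.2 fun i hi => by
          have h1 := hy.2 ⟨i, by omega⟩
          have h2 := hxw ⟨i, by omega⟩
          simp only at h1 h2
          rw [h1, h2]
      refine (measure_mono hsub).trans ?_
      rw [hc, ← ENNReal.ofReal_prod_of_nonneg fun i _ => (Real.exp_pos _).le,
        ← ENNReal.ofReal_mul (by positivity), ← Real.exp_sum]
      refine ENNReal.ofReal_le_ofReal ?_
      have hbs : birkhoff A φ n x ≤ ∑ i ∈ Finset.range n, s (x.seq i) :=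
        Finset.sum_le_sum fun i _ => by simpa [shiftMap_iterate_seq] using hφs ((shiftMap A)^[i] x)
      have hws : ∑ i, s (w i) = ∑ i ∈ Finset.range n, s (x.seq i) + s (x.seq n) := by
        rw [← Finset.sum_range_succ, Finset.sum_range]
        exact Finset.sum_congr rfl fun i _ => by rw [hxw i]
      have hexp : t * birkhoff A φ n x - n * p ≤
          -s (x.seq n) + (n * ((t - 1) * β - p) + ∑ i, s (w i)) := by
        rw [hws]
        nlinarith [hxB.2.2, mul_le_mul_of_nonneg_left hxB.2.2 (sub_nonneg.2 ht)]
      calc u (x.seq 0) * v (x.seq n) * Real.exp (t * birkhoff A φ n x - n * p)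
          ≤ u (x.seq 0) * v (x.seq n) * Real.exp
              (-s (x.seq n) + (n * ((t - 1) * β - p) + ∑ i, s (w i))) := by
            have := mul_pos (hu (x.seq 0)) (hv (x.seq n))
            gcongr
        _ = u (x.seq 0) * v (x.seq n) * Real.exp (-s (x.seq n)) *
              (Real.exp ((t - 1) * β - p) ^ n * Real.exp (∑ i, s (w i))) := by
            rw [Real.exp_add, Real.exp_add, Real.exp_nat_mul]; ring
        _ ≤ |C| * (Real.exp ((t - 1) * β - p) ^ n * Real.exp (∑ i, s (w i))) := by
            gcongr
            exact (hC _ hxB.1 _ hxB.2.1).trans (le_abs_self C)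
        _ = _ := by ring
  calc μ B ≤ ∑' w : Fin (n + 1) → ℕ, μ (B ∩ {x | ∀ i : Fin (n + 1), x.seq i = w i}) :=
        (measure_mono hcover).trans (measure_iUnion_le _)
    _ ≤ ∑' w : Fin (n + 1) → ℕ, ENNReal.ofReal (|C| * Real.exp ((t - 1) * β - p) ^ n) *
        ∏ i, ENNReal.ofReal (Real.exp (s (w i))) := ENNReal.tsum_le_tsum hcyl
    _ = ENNReal.ofReal (|C| * Real.exp ((t - 1) * β - p) ^ n) * ENNReal.ofReal Z ^ (n + 1) := by
        rw [ENNReal.tsum_mul_left, tsum_prod_fin (fun a => ENNReal.ofReal (Real.exp (s a))),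
          ENNReal.ofReal_tsum_of_nonneg (fun i => (Real.exp_pos _).le) hs]
    _ = ENNReal.ofReal (|C| * Z * (Real.exp ((t - 1) * β - p) * Z) ^ n) := by
        rw [← ENNReal.ofReal_pow hZ0, ← ENNReal.ofReal_mul (by positivity)]
        congr 1; ring

theorem continuous_of_markov {ψ : ℕ → ℕ → ℝ} {φ : MShift A → ℝ}
    (hφ : ∀ x, φ x = ψ (x.seq 0) (x.seq 1)) : Continuous φ := by
  have : φ = (fun q : ℕ × ℕ => ψ q.1 q.2) ∘ fun x => (x.seq 0, x.seq 1) := funext hφ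
  rw [this]
  exact continuous_of_discreteTopology.comp
    ((MShift.continuous_seq 0).prodMk (MShift.continuous_seq 1))

/-- If the pressure is large, every truncation of `φ` has average at least `β` with respect to
the Gurevich–Markov measure of `t φ`. -/
theorem IsGM.le_integral_max {ψ : ℕ → ℕ → ℝ} {φ : MShift A → ℝ}
    (hφ : ∀ x, φ x = ψ (x.seq 0) (x.seq 1)) {s : ℕ → ℝ} (hs : Summable fun i => Real.exp (s i))
    (hφs : ∀ x, φ x ≤ s (x.seq 0)) {K : ℝ} (hK : ∀ x, φ x ≤ K) {t p β : ℝ} (ht : 1 ≤ t)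
    {μ : Measure (MShift A)} (h : IsGM A (fun u v => t * ψ u v) p μ)
    (hβ : Real.exp ((t - 1) * β - p) * ∑' i, Real.exp (s i) < 1) (M : ℝ) :
    β ≤ ∫ x, max (φ x) M ∂μ := by
  have := h.prob
  have hmeas : Measurable φ := (continuous_of_markov hφ).measurable
  have hint : Integrable (fun x => max (φ x) M) μ :=
    .of_mem_Icc M (max K M) (hmeas.max measurable_const).aemeasurable
      (.of_forall fun x => ⟨le_max_right _ _, max_le_max_right _ (hK x)⟩)
  have key : ∫ x, -max (φ x) M ∂μ ≤ -β := by
    refine h.inv.integral_le_of_birkhoff_le hint.neg (K := -M)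
      (fun x => neg_le_neg (le_max_right _ _)) fun δ hδ => ⟨0, ?_⟩
    obtain ⟨N, hN⟩ := h.inv.exists_measure_endpoints_le (half_pos hδ)
    obtain ⟨C, hC⟩ := h.exists_measure_birkhoff_le hφ hs hφs (β := β) ht N
    have hlim := (tendsto_pow_atTop_nhds_zero_of_lt_one
      (mul_nonneg (Real.exp_pos _).le (tsum_nonneg fun i => (Real.exp_pos (s i)).le)) hβ).const_mul C
    rw [mul_zero] at hlim
    filter_upwards [hlim.eventually_le_const (half_pos hδ)] with n hn
    have hBm : MeasurableSet {x | x.seq 0 < N ∧ x.seq n < N ∧ birkhoff A φ n x ≤ n * β} :=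
      (((MShift.continuous_seq 0).measurable measurableSet_Iio)).inter
        (((MShift.continuous_seq n).measurable measurableSet_Iio).inter
          (measurable_birkhoff hmeas n measurableSet_Iic))
    refine ⟨_, ((measurableSet_le_seq 0 N).union (measurableSet_le_seq n N)).union hBm,
      (measureReal_union_le _ _).trans ?_, fun x hx => ?_⟩
    · linarith [hN n, hC n]
    · simp only [Set.mem_union, Set.mem_ofPred_eq, not_or, not_le, not_and] at hx
      have h1 := hx.2 hx.1.1 hx.1.2
      have h2 : birkhoff A φ n x ≤ ∑ i ∈ Finset.range n, max (φ ((shiftMap A)^[i] x)) M :=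
        Finset.sum_le_sum fun i _ => le_max_left _ _
      simp only [birkhoff, Pi.neg_apply, Finset.sum_neg_distrib] at h1 h2 ⊢
      linarith
  rw [integral_neg] at key
  linarith

/-- The eigenfunction inequality along a path. -/
theorem exp_pathWt_mul_le {ψ : ℕ → ℕ → ℝ} {p : ℝ} {u : ℕ → ℝ} (hu : ∀ a, 0 < u a)
    (h : ∀ j, (∑' a : {a : ℕ // A a j}, ENNReal.ofReal (Real.exp (ψ a.1 j) * u a.1))
      = ENNReal.ofReal (Real.exp p * u j)) (a : ℕ) (l : List ℕ) (hl : (a :: l).IsChain A) :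
    Real.exp (pathWt ψ (a :: l)) * u a ≤ Real.exp (l.length * p) * u (l.getLastD a) := by
  induction l generalizing a with
  | nil => simp [pathWt]
  | cons b l ih =>
    rw [List.isChain_cons_cons] at hl
    have h1 : Real.exp (ψ a b) * u a ≤ Real.exp p * u b := by
      have hub := hu b
      refine (ENNReal.ofReal_le_ofReal_iff (by positivity)).1 ?_
      rw [← h b]
      exact ENNReal.le_tsum (f := fun a : {a : ℕ // A a b} =>
        ENNReal.ofReal (Real.exp (ψ a.1 b) * u a.1)) ⟨a, hl.1⟩
    have h2 := ih b hl.2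
    rw [pathWt, Real.exp_add, List.getLastD_cons, List.length_cons, Nat.cast_succ, add_mul,
      one_mul, Real.exp_add]
    calc Real.exp (ψ a b) * Real.exp (pathWt ψ (b :: l)) * u a
        = Real.exp (pathWt ψ (b :: l)) * (Real.exp (ψ a b) * u a) := by ring
      _ ≤ Real.exp (pathWt ψ (b :: l)) * (Real.exp p * u b) := by gcongr
      _ = Real.exp p * (Real.exp (pathWt ψ (b :: l)) * u b) := by ring
      _ ≤ Real.exp p * (Real.exp (l.length * p) * u (l.getLastD b)) := by gcongr
      _ = _ := by ring

/-- The average of `ψ` over a loop gives a lower bound for the pressure of `t ψ`. -/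
theorem exists_mul_le_pressure (hTrans : TopTrans A) (ψ : ℕ → ℕ → ℝ) :
    ∃ c : ℝ, ∀ (t p : ℝ) (μ : Measure (MShift A)),
      IsGM A (fun u v => t * ψ u v) p μ → t * c ≤ p := by
  obtain ⟨w, ⟨hlen, hchain, -⟩, hhead, hlast⟩ := hTrans 0 0
  obtain ⟨a, b, l, rfl⟩ : ∃ a b l, w = a :: b :: l := by
    match w, hlen with
    | a :: b :: l, _ => exact ⟨a, b, l, rfl⟩
  refine ⟨pathWt ψ (a :: b :: l) / ((b :: l).length : ℝ), fun t p μ h => ?_⟩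
  obtain ⟨u, -, hu, -, he, -⟩ := h.eigen
  have h1 := exp_pathWt_mul_le (ψ := fun u v => t * ψ u v) hu he a (b :: l) hchain
  obtain rfl : a = 0 := hhead
  rw [List.getLastD_cons] at hlast
  rw [hlast, pathWt_const_mul] at h1
  have h2 := Real.exp_le_exp.1 (le_of_mul_le_mul_right h1 (hu 0))
  have hpos : (0 : ℝ) < ((b :: l).length : ℝ) := by simp; positivity
  rw [← mul_div_assoc, div_le_iff₀ hpos]
  linarith

/-- Lower bounds on the averages of all truncations of a function bounded above pass to the
function itself. -/
theorem integrable_and_le_integral_of_le_integral_max {Ω : Type*} [MeasurableSpace Ω]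
    {μ : Measure Ω} [IsProbabilityMeasure μ] {f : Ω → ℝ} (hf : Measurable f) {K c : ℝ}
    (hK : ∀ x, f x ≤ K) (h : ∀ M : ℝ, c ≤ ∫ x, max (f x) M ∂μ) :
    Integrable f μ ∧ c ≤ ∫ x, f x ∂μ := by
  have hint (M : ℝ) : Integrable (fun x => max (f x) M) μ :=
    .of_mem_Icc M (max K M) (hf.max measurable_const).aemeasurable
      (.of_forall fun x => ⟨le_max_right _ _, max_le_max_right _ (hK x)⟩)
  have hlim (x : Ω) : liminf (fun n : ℕ => ENNReal.ofReal (K - max (f x) (-n))) atTop =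
      ENNReal.ofReal (K - f x) := by
    refine (tendsto_const_nhds.congr' ?_).liminf_eq
    filter_upwards [eventually_ge_atTop ⌈-f x⌉₊] with n hn
    rw [max_eq_left (by linarith [Nat.ceil_le.1 hn])]
  have hle : ∫⁻ x, ENNReal.ofReal (K - f x) ∂μ ≤ ENNReal.ofReal (K - c) := by
    simp_rw [← hlim]
    refine (lintegral_liminf_le fun n => by fun_prop).trans ?_
    refine (liminf_le_liminf (v := fun _ => ENNReal.ofReal (K - c)) ?_).trans_eq
      (liminf_const _)
    filter_upwards [eventually_ge_atTop ⌈-K⌉₊] with n hn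
    rw [← ofReal_integral_eq_lintegral_ofReal (f := fun x => K - max (f x) (-n))
      ((integrable_const K).sub (hint _))
      (.of_forall fun x => sub_nonneg.2 (max_le (hK x) (by linarith [Nat.ceil_le.1 hn]))),
      integral_sub (integrable_const K) (hint _)]
    refine ENNReal.ofReal_le_ofReal ?_
    simp only [integral_const, probReal_univ, one_smul]
    linarith [h (-n)]
  have hcK : c ≤ K := by
    refine (h K).trans_eq ?_
    simp [max_eq_right (hK _)]
  have h0 : 0 ≤ᵐ[μ] fun x => K - f x := .of_forall fun x => sub_nonneg.2 (hK x)
  have hI : Integrable (fun x => K - f x) μ :=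
    ⟨(measurable_const.sub hf).aestronglyMeasurable,
      (hasFiniteIntegral_iff_ofReal h0).2 (hle.trans_lt ENNReal.ofReal_lt_top)⟩
  have hfI : Integrable f μ := by
    simpa [Pi.sub_def] using (integrable_const K).sub hI
  refine ⟨hfI, ?_⟩
  rw [← ofReal_integral_eq_lintegral_ofReal hI h0,
    ENNReal.ofReal_le_ofReal_iff (sub_nonneg.2 hcK), integral_sub (integrable_const K) hfI] at hle
  simp only [integral_const, probReal_univ, one_smul] at hle
  linarith

theorem shiftInv_of_tendsto {μ : ℕ → Measure (MShift A)} (hμ : ∀ k, ShiftInv A (μ k))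
    {ν : Measure (MShift A)} [IsProbabilityMeasure ν]
    (h : ∀ f : BoundedContinuousFunction (MShift A) ℝ,
      Tendsto (fun k => ∫ x, f x ∂(μ k)) atTop (𝓝 (∫ x, f x ∂ν))) : ShiftInv A ν := by
  have hm : Measurable (shiftMap A) := continuous_shiftMap.measurable
  have : IsProbabilityMeasure (ν.map (shiftMap A)) :=
    Measure.isProbabilityMeasure_map hm.aemeasurable
  have heq : ν.map (shiftMap A) = ν := by
    refine ext_of_forall_integral_eq_of_IsFiniteMeasure fun f => ?_
    rw [integral_map hm.aemeasurable f.continuous.measurable.aestronglyMeasurable]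
    refine tendsto_nhds_unique (h (f.compContinuous ⟨_, continuous_shiftMap⟩)) ?_
    refine (h f).congr fun k => ?_
    have := integral_map (μ := μ k) hm.aemeasurable f.continuous.measurable.aestronglyMeasurable
    rw [(hμ k).measurePreserving.map_eq] at this
    exact this
  intro s hs
  rw [← Measure.map_apply hm hs, heq]

end MarkovShift

/-- Any weak* accumulation point of the family of Gurevich–Markov
equilibrium states `(μ_t)` as `t → ∞` is a σ-invariant `φ`-maximizing measure. -/
theorem stmt3 (A : ℕ → ℕ → Prop) (hA : NoZeroRC A) (hTrans : TopTrans A)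
    (ψ : ℕ → ℕ → ℝ) (φ : MShift A → ℝ) (hMarkov : ∀ x, φ x = ψ (x.seq 0) (x.seq 1))
    (hsum : SummablePot A φ) (V : ℝ) (hV : VarBdd A φ 1 V)
    (hfin : ∀ a : ℕ, PGur A φ a < ⊤)
    (P : ℝ → ℝ) (μ : ℝ → Measure (MShift A))
    (hP : ∀ t : ℝ, 1 ≤ t → IsPG A (fun x => t * φ x) ((P t : ℝ) : EReal))
    (hGM : ∀ t : ℝ, 1 ≤ t → IsGM A (fun u v => t * ψ u v) (P t) (μ t))
    (ts : ℕ → ℝ) (hts1 : ∀ k, 1 ≤ ts k) (htsTop : Tendsto ts atTop atTop)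
    (μlim : Measure (MShift A)) (hprob : IsProbabilityMeasure μlim)
    (hconv : ∀ f : BoundedContinuousFunction (MShift A) ℝ,
      Tendsto (fun k : ℕ => ∫ x, f x ∂(μ (ts k))) atTop (𝓝 (∫ x, f x ∂μlim))) :
    ShiftInv A μlim ∧ Integrable φ μlim ∧ ∫ x, φ x ∂μlim = alphaSup A φ := by
  have hcont : Continuous φ := continuous_of_markov hMarkov
  obtain ⟨s, hs, hφs⟩ := hsum
  replace hφs : ∀ x, φ x ≤ s (x.seq 0) := fun x => hφs _ x rfl
  set Z : ℝ := ∑' i, Real.exp (s i) with hZ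
  have hZ0 : 0 < Z := hs.tsum_pos (fun i => (Real.exp_pos _).le) 0 (Real.exp_pos _)
  have hK (x) : φ x ≤ Real.log Z :=
    (hφs x).trans <| (Real.le_log_iff_exp_le hZ0).2 <|
      hs.le_tsum _ fun i _ => (Real.exp_pos _).le
  have hinv : ShiftInv A μlim := shiftInv_of_tendsto (fun k => (hGM _ (hts1 k)).inv) hconv
  have lower (c : ℝ) (hc : ∀ t, 1 ≤ t → t * c ≤ P t) :
      Integrable φ μlim ∧ c ≤ ∫ x, φ x ∂μlim := by
    refine integrable_and_le_integral_of_le_integral_max hcont.measurable hK fun M => ?_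
    refine le_of_forall_lt fun β hβ => ?_
    obtain ⟨β', hβ', hβc⟩ := exists_between hβ
    refine hβ'.trans_le ?_
    let f : BoundedContinuousFunction (MShift A) ℝ :=
      .ofNormedAddCommGroup (fun x => max (φ x) M) (hcont.max continuous_const)
        (max |Real.log Z| |M|) fun x => by
          rw [Real.norm_eq_abs]
          exact abs_le.2 ⟨(neg_le_neg (le_max_right _ _)).trans
            ((neg_abs_le M).trans (le_max_right _ _)), max_le_max ((hK x).trans (le_abs_self _))
              (le_abs_self M)⟩
    refine ge_of_tendsto (hconv f) ?_
    filter_upwards [htsTop.eventually_gt_atTop ((Real.log Z - β') / (c - β'))] with k hk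
    refine (hGM _ (hts1 k)).le_integral_max hMarkov hs hφs hK (hts1 k) ?_ M
    rw [div_lt_iff₀ (sub_pos.2 hβc)] at hk
    rw [← hZ, ← Real.exp_log hZ0, ← Real.exp_add, Real.exp_lt_one_iff]
    have := hc _ (hts1 k)
    linarith
  obtain ⟨c, hc⟩ := exists_mul_le_pressure hTrans ψ
  have hint : Integrable φ μlim := (lower c fun t ht => hc t _ _ (hGM t ht)).1
  have hmem : ∫ x, φ x ∂μlim ∈ {r : ℝ | ∃ μ : Measure (MShift A), IsProbabilityMeasure μ ∧
      ShiftInv A μ ∧ Integrable φ μ ∧ r = ∫ x, φ x ∂μ} := ⟨μlim, hprob, hinv, hint, rfl⟩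
  refine ⟨hinv, hint, le_antisymm (le_csSup ⟨P 1 / 1, ?_⟩ hmem) (csSup_le ⟨_, hmem⟩ ?_)⟩
  · rintro _ ⟨ν, hν, hνinv, hνint, rfl⟩
    exact (hGM 1 le_rfl).integral_le hMarkov hK one_pos hνinv hνint
  · rintro _ ⟨ν, hν, hνinv, hνint, rfl⟩
    refine (lower _ fun t ht => ?_).2
    have := (hGM t ht).integral_le hMarkov hK (by linarith) hνinv hνint
    rwa [le_div_iff₀' (by linarith)] at this
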